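/- arXiv:2001.04743 — 11 statements merged into one kernel-verified Lean document; each statement's English description precedes it below -/
import Mathlib

section
/- Let p and q be integers with 1 + |p| < |q|, and let t(x) = x² + px − q ∈ ℤ[x]. Call a polynomial g ∈ ℤ[x] reduced if every coefficient a of g satisfies |a| ≤ |q| − 1. Then every polynomial f ∈ ℤ[x] is equivalent to a reduced polynomial, i.e., there exists a reduced g ∈ ℤ[x] such that t divides f − g in ℤ[x]. -/
open Polynomial

/-- If `a = r + q * c`, then `a + b X ∼ r + X * ((b + p * c) + c X)` modulo `X² + pX - q`, so
a reduced representative of the second factor yields one of `a + b X`. -/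
theorem exists_reduced_linear_of_shift {p q a b c r : ℤ} (hr : |r| < |q|) (ha : a = r + q * c)
    (h : ∃ g : ℤ[X], (∀ i, |g.coeff i| < |q|) ∧
      (X ^ 2 + C p * X - C q) ∣ (C (b + p * c) + C c * X - g)) :
    ∃ g : ℤ[X], (∀ i, |g.coeff i| < |q|) ∧
      (X ^ 2 + C p * X - C q) ∣ (C a + C b * X - g) := by
  obtain ⟨g, hg, k, hk⟩ := h
  refine ⟨C r + X * g, ?_, X * k - C c, ?_⟩
  · rintro (_ | i)
    · simpa using hr
    · rw [coeff_add, coeff_C_succ, coeff_X_mul, zero_add]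
      exact hg i
  · subst ha
    simp only [map_add, map_mul] at hk ⊢
    linear_combination X * hk

/-- Every integer polynomial of degree at most one has a reduced representative modulo
`X² + pX - q`. -/
theorem exists_reduced_linear {p q : ℤ} (hpq : 1 + |p| < |q|) (a b : ℤ) :
    ∃ g : ℤ[X], (∀ i, |g.coeff i| < |q|) ∧
      (X ^ 2 + C p * X - C q) ∣ (C a + C b * X - g) := by
  have hq : 0 < |q| := by linarith [abs_nonneg p]
  induction hn : a.natAbs + b.natAbs using Nat.strong_induction_on generalizing a b with
  | _ n ih =>
    have of_ne_zero (a b : ℤ) (ha : a ≠ 0) (hab : a.natAbs + b.natAbs = n) :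
        ∃ g : ℤ[X], (∀ i, |g.coeff i| < |q|) ∧
          (X ^ 2 + C p * X - C q) ∣ (C a + C b * X - g) := by
      have hr : |a.tmod q| < |q| := by
        rw [Int.abs_eq_natAbs, Int.abs_eq_natAbs, Int.natAbs_tmod]
        exact_mod_cast Nat.mod_lt _ (Int.natAbs_pos.mpr (abs_pos.mp hq))
      have hc : |q| * |a.tdiv q| ≤ |a| := by
        rw [Int.abs_eq_natAbs, Int.abs_eq_natAbs, Int.abs_eq_natAbs, Int.natAbs_tdiv]
        exact_mod_cast Nat.mul_div_le _ _
      refine exists_reduced_linear_of_shift hr (Int.tmod_add_mul_tdiv a q).symm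
        (ih _ ?_ _ _ rfl)
      have hadd := abs_add_le b (p * a.tdiv q)
      rw [abs_mul] at hadd
      have hlt : |b + p * a.tdiv q| + |a.tdiv q| < |a| + |b| := by
        rcases (abs_nonneg (a.tdiv q)).eq_or_lt with h0 | h0
        · rw [← h0] at hadd ⊢
          linarith [abs_pos.mpr ha]
        · nlinarith
      rw [← hab]
      zify
      exact hlt
    by_cases ha : a = 0
    · by_cases hb : b = 0
      · exact ⟨0, by simpa using hq, by simp [ha, hb]⟩
      · refine exists_reduced_linear_of_shift (c := 0) (r := 0) (by simpa using hq)
          (by simp [ha]) ?_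
        exact of_ne_zero _ _ (by simpa using hb) (by simp; omega)
    · exact of_ne_zero a b ha hn

/-- Every integer polynomial is equivalent, modulo `t = X² + pX − q` with `1 + |p| < |q|`,
to a reduced polynomial (all coefficients of absolute value less than `|q|`). -/
theorem every_poly_equiv_reduced (p q : ℤ) (hpq : 1 + |p| < |q|) (f : Polynomial ℤ) :
    ∃ g : Polynomial ℤ, (∀ i, |g.coeff i| < |q|) ∧
      (X ^ 2 + C p * X - C q) ∣ (f - g) := by
  have ht : (X ^ 2 + C p * X - C q : ℤ[X]).Monic := by monicity!
  have hdeg : (X ^ 2 + C p * X - C q : ℤ[X]).natDegree = 2 := by compute_degree!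
  have hlt := natDegree_modByMonic_lt f ht (fun h => by rw [h, natDegree_one] at hdeg; omega)
  obtain ⟨b, a, hab⟩ := exists_eq_X_add_C_of_natDegree_le_one (by omega :
    (f %ₘ (X ^ 2 + C p * X - C q)).natDegree ≤ 1)
  obtain ⟨g, hg, k, hk⟩ := exists_reduced_linear hpq a b
  refine ⟨g, hg, f /ₘ (X ^ 2 + C p * X - C q) + k, ?_⟩
  linear_combination hk + hab - modByMonic_add_div f (X ^ 2 + C p * X - C q)
end

section
/- Let n ≥ 2 and let t(x) = xⁿ + p_{n−1}x^{n−1} + ⋯ + p₁x − q ∈ ℤ[x] with integer coefficients satisfying 1 + |p_{n−1}| + ⋯ + |p₁| < |q|. Then every polynomial f ∈ ℤ[x] is equivalent to a reduced polynomial, i.e., there exists g ∈ ℤ[x] with every coefficient of g of absolute value at most |q| − 1 such that t divides f − g in ℤ[x]. -/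
open Polynomial Finset

/-- The sum of the absolute values of the coefficients of an integer polynomial. -/
def Polynomial.coeffAbsSum (f : Polynomial ℤ) : ℤ := ∑ i ∈ f.support, |f.coeff i|

namespace Polynomial

lemma coeffAbsSum_eq_of_subset {f : Polynomial ℤ} {s : Finset ℕ} (h : f.support ⊆ s) :
    f.coeffAbsSum = ∑ i ∈ s, |f.coeff i| :=
  Finset.sum_subset h fun i _ hi => by simp [notMem_support_iff.mp hi]

lemma coeffAbsSum_nonneg (f : Polynomial ℤ) : 0 ≤ f.coeffAbsSum :=
  Finset.sum_nonneg fun _ _ => abs_nonneg _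

lemma coeffAbsSum_zero : (0 : Polynomial ℤ).coeffAbsSum = 0 := by
  simp [coeffAbsSum]

lemma coeffAbsSum_add_le (f g : Polynomial ℤ) :
    (f + g).coeffAbsSum ≤ f.coeffAbsSum + g.coeffAbsSum := by
  rw [coeffAbsSum_eq_of_subset (support_add (p := f) (q := g)),
    coeffAbsSum_eq_of_subset (subset_union_left (s₁ := f.support) (s₂ := g.support)),
    coeffAbsSum_eq_of_subset (subset_union_right (s₁ := f.support) (s₂ := g.support)),
    ← Finset.sum_add_distrib]
  exact Finset.sum_le_sum fun i _ => by simpa using abs_add_le (f.coeff i) (g.coeff i)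

lemma coeffAbsSum_sum_le (s : Finset ℕ) (F : ℕ → Polynomial ℤ) :
    (∑ i ∈ s, F i).coeffAbsSum ≤ ∑ i ∈ s, (F i).coeffAbsSum :=
  Finset.le_sum_of_subadditive _ coeffAbsSum_zero.le coeffAbsSum_add_le s F

lemma coeffAbsSum_monomial (k : ℕ) (c : ℤ) : (monomial k c).coeffAbsSum = |c| := by
  rw [coeffAbsSum_eq_of_subset (support_monomial_subset k c)]
  simp

lemma coeffAbsSum_erase (f : Polynomial ℤ) (k : ℕ) :
    (f.erase k).coeffAbsSum + |f.coeff k| = f.coeffAbsSum := by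
  by_cases hk : k ∈ f.support
  · rw [coeffAbsSum, coeffAbsSum, support_erase, ← Finset.sum_erase_add _ _ hk]
    congr 1
    exact Finset.sum_congr rfl fun i hi => by rw [Polynomial.coeff_erase, if_neg (Finset.ne_of_mem_erase hi)]
  · rw [coeffAbsSum, coeffAbsSum, support_erase, Finset.erase_eq_of_notMem hk,
      notMem_support_iff.mp hk, abs_zero, add_zero]
    exact Finset.sum_congr rfl fun i hi => by
      rw [Polynomial.coeff_erase, if_neg (ne_of_mem_of_not_mem hi hk)]

/-- Adding a signed shift of `t = Xⁿ + ∑ pᵢ Xⁱ - q` to cancel `|q|` from a coefficient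
of absolute value at least `|q|` decreases the sum of the absolute values of the coefficients. -/
lemma exists_coeffAbsSum_add_mul_lt (n : ℕ) (p : ℕ → ℤ) (q : ℤ)
    (hpq : 1 + ∑ i ∈ Finset.Ico 1 n, |p i| < |q|) (f : Polynomial ℤ) (k : ℕ)
    (hk : |q| ≤ |f.coeff k|) :
    ∃ u : Polynomial ℤ,
      (f + (X ^ n + (∑ i ∈ Finset.Ico 1 n, C (p i) * X ^ i) - C q) * u).coeffAbsSum
        < f.coeffAbsSum := by
  obtain ⟨e, he, hq⟩ : ∃ e : ℤ, |e| = 1 ∧ |f.coeff k - q * e| = |f.coeff k| - |q| := by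
    rcases abs_cases (f.coeff k) with h | h <;> rcases abs_cases q with h' | h'
    · exact ⟨1, by simp, by rw [abs_of_nonneg] <;> linarith⟩
    · exact ⟨-1, by simp, by rw [abs_of_nonneg] <;> linarith⟩
    · exact ⟨-1, by simp, by rw [abs_of_nonpos] <;> linarith⟩
    · exact ⟨1, by simp, by rw [abs_of_nonpos] <;> linarith⟩
  refine ⟨monomial k e, ?_⟩
  have key : f + (X ^ n + (∑ i ∈ Finset.Ico 1 n, C (p i) * X ^ i) - C q) * monomial k e =
      f.erase k + monomial k (f.coeff k - q * e) +
        (monomial (n + k) e + ∑ i ∈ Finset.Ico 1 n, monomial (i + k) (p i * e)) := by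
    conv_lhs => rw [← monomial_add_erase f k]
    simp only [sub_mul, add_mul, Finset.sum_mul, X_pow_eq_monomial,
      monomial_mul_monomial, C_mul_monomial, one_mul, mul_one, map_sub]
    abel
  have hsum : (∑ i ∈ Finset.Ico 1 n, monomial (i + k) (p i * e)).coeffAbsSum ≤
      ∑ i ∈ Finset.Ico 1 n, |p i| :=
    (coeffAbsSum_sum_le _ _).trans_eq <| Finset.sum_congr rfl fun i _ => by
      rw [coeffAbsSum_monomial, abs_mul, he, mul_one]
  rw [key]
  have h₁ := coeffAbsSum_add_le (f.erase k + monomial k (f.coeff k - q * e))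
    (monomial (n + k) e + ∑ i ∈ Finset.Ico 1 n, monomial (i + k) (p i * e))
  have h₂ := coeffAbsSum_add_le (f.erase k) (monomial k (f.coeff k - q * e))
  have h₃ := coeffAbsSum_add_le (monomial (n + k) e)
    (∑ i ∈ Finset.Ico 1 n, monomial (i + k) (p i * e))
  rw [coeffAbsSum_monomial] at h₂ h₃
  have h₄ := coeffAbsSum_erase f k
  linarith

end Polynomial

/-- For `t = Xⁿ + p_{n−1}X^{n−1} + ⋯ + p₁X − q` with `1 + |p_{n−1}| + ⋯ + |p₁| < |q|`,
every integer polynomial is equivalent modulo `t` to a reduced polynomial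
(all coefficients of absolute value less than `|q|`). -/
theorem every_poly_equiv_reduced_general (n : ℕ) (hn : 2 ≤ n) (p : ℕ → ℤ) (q : ℤ)
    (hpq : 1 + ∑ i ∈ Finset.Ico 1 n, |p i| < |q|) (f : Polynomial ℤ) :
    ∃ g : Polynomial ℤ, (∀ i, |g.coeff i| < |q|) ∧
      (X ^ n + (∑ i ∈ Finset.Ico 1 n, C (p i) * X ^ i) - C q) ∣ (f - g) := by
  induction hm : f.coeffAbsSum.toNat using Nat.strong_induction_on generalizing f with
  | _ m ih =>
    by_cases hf : ∀ i, |f.coeff i| < |q|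
    · exact ⟨f, hf, by simp⟩
    · push Not at hf
      obtain ⟨k, hk⟩ := hf
      obtain ⟨u, hu⟩ := exists_coeffAbsSum_add_mul_lt n p q hpq f k hk
      have h₀ := coeffAbsSum_nonneg
        (f + (X ^ n + (∑ i ∈ Finset.Ico 1 n, C (p i) * X ^ i) - C q) * u)
      obtain ⟨g, hg, hdvd⟩ := ih _ (hm ▸ (Int.toNat_lt_toNat (h₀.trans_lt hu)).mpr hu) _ rfl
      refine ⟨g, hg, ?_⟩
      rw [add_sub_right_comm f] at hdvd
      exact (dvd_add_left (dvd_mul_right _ u)).mp hdvd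
end

section
/- Let p and q be integers with 1 + |p| < |q|. Suppose r₀, r₁, a, b are integers with |r₁| ≤ |q| − 1, |r₀| ≤ (|q| − 1)², |a| ≤ |q| − 1, |b| ≤ |q| − 1, and q divides r₀ + a − b. Then the exact quotient s = (r₀ + a − b)/q satisfies |s| ≤ |q| − 1 and |r₁ + p·s| ≤ (|q| − 1)². (Hence the carries in the equivalence-checking algorithm stay bounded by |q| − 1 and (|q| − 1)² throughout.) -/
/-- Invariant of the equivalence-checking algorithm: if the carries satisfy
`|r₁| ≤ |q| − 1`, `|r₀| ≤ (|q| − 1)²`, the coefficients satisfy `|a|, |b| ≤ |q| − 1`,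
and `q ∣ r₀ + a − b`, then the exact quotient `s = (r₀ + a − b)/q` satisfies
`|s| ≤ |q| − 1` and the new carry `r₁ + p·s` satisfies `|r₁ + p·s| ≤ (|q| − 1)²`. -/
theorem carries_stay_bounded (p q r₀ r₁ a b : ℤ) (hpq : 1 + |p| < |q|)
    (hr₁ : |r₁| ≤ |q| - 1) (hr₀ : |r₀| ≤ (|q| - 1) ^ 2)
    (ha : |a| ≤ |q| - 1) (hb : |b| ≤ |q| - 1)
    (s : ℤ) (hs : q * s = r₀ + a - b) :
    |s| ≤ |q| - 1 ∧ |r₁ + p * s| ≤ (|q| - 1) ^ 2 := by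
  have hqs : |q| * |s| ≤ (|q| - 1) ^ 2 + (|q| - 1) + (|q| - 1) := by
    rw [← abs_mul, hs]
    linarith [abs_sub (r₀ + a) b, abs_add_le r₀ a]
  have hs_le : |s| ≤ |q| - 1 := by
    by_contra! h
    have hq : |q| ≤ |s| := by omega
    nlinarith [mul_le_mul_of_nonneg_left hq (abs_nonneg q)]
  refine ⟨hs_le, ?_⟩
  have hp : |p| ≤ |q| - 2 := by omega
  have hps : |p| * |s| ≤ (|q| - 2) * (|q| - 1) :=
    mul_le_mul hp hs_le (abs_nonneg s) ((abs_nonneg p).trans hp)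
  calc |r₁ + p * s| ≤ |r₁| + |p| * |s| := abs_mul p s ▸ abs_add_le r₁ (p * s)
    _ ≤ (|q| - 1) + (|q| - 2) * (|q| - 1) := add_le_add hr₁ hps
    _ = (|q| - 1) ^ 2 := by ring
end

section
/- Let p and q be integers with 1 + |p| < |q| and t(x) = x² + px − q. If f, g ∈ ℤ[x] are both reduced (all coefficients of absolute value at most |q| − 1), t divides f − g, and x^k divides f, then x^k divides g. -/
open Polynomial

/-- If two reduced polynomials are equivalent modulo `t = X² + pX − q` (with `1 + |p| < |q|`)
and `X^k` divides one of them, then `X^k` divides the other. -/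
theorem reduced_equiv_same_zeros (p q : ℤ) (hpq : 1 + |p| < |q|)
    (f g : Polynomial ℤ) (hf : ∀ i, |f.coeff i| < |q|) (hg : ∀ i, |g.coeff i| < |q|)
    (hdvd : (X ^ 2 + C p * X - C q) ∣ (f - g)) (k : ℕ) (hxf : X ^ k ∣ f) :
    X ^ k ∣ g := by
  have hq : q ≠ 0 := by
    rintro rfl
    have := abs_nonneg p
    simp only [abs_zero] at hpq
    linarith
  induction k generalizing f g with
  | zero => simp
  | succ k ih =>
    obtain ⟨f, rfl⟩ : X ∣ f := (Dvd.intro_left _ (pow_succ X k).symm).trans hxf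
    obtain ⟨h, hh⟩ := hdvd
    have h0 := congrArg (fun r : ℤ[X] => r.coeff 0) hh
    simp only [coeff_sub, mul_coeff_zero, coeff_add, coeff_X_zero, coeff_C_zero, zero_mul,
      mul_zero, pow_two, zero_sub, zero_add, neg_mul, neg_inj] at h0
    have hg0 : g.coeff 0 = 0 :=
      Int.eq_zero_of_abs_lt_dvd ((abs_dvd q _).2 ⟨_, h0⟩) (hg 0)
    have hh0 : h.coeff 0 = 0 := by
      rw [hg0, eq_comm, mul_eq_zero] at h0
      exact h0.resolve_left hq
    obtain ⟨g, rfl⟩ := X_dvd_iff.2 hg0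
    obtain ⟨h, rfl⟩ := X_dvd_iff.2 hh0
    rw [pow_succ', mul_dvd_mul_iff_left X_ne_zero] at hxf ⊢
    refine ih f g (fun i => ?_) (fun i => ?_) ⟨h, mul_left_cancel₀ X_ne_zero ?_⟩ hxf
    · simpa only [coeff_X_mul] using hf (i + 1)
    · simpa only [coeff_X_mul] using hg (i + 1)
    · linear_combination hh
end

section
/- Let p and q be integers with 1 + |p| < |q| and t(x) = x² + px − q. For every k ≥ 1, the integer q^k (viewed as a constant polynomial) starts with at least k zeros in reduced form: there exists a reduced polynomial g ∈ ℤ[x] (all coefficients of absolute value at most |q| − 1) such that x^k divides g and t divides q^k − g in ℤ[x]. -/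
open Polynomial

theorem Int.exists_eq_mul_add_abs_lt (a : ℤ) {q : ℤ} (hq : q ≠ 0) :
    ∃ s r : ℤ, a = q * s + r ∧ |q| * |s| ≤ |a| ∧ |r| < |q| := by
  refine ⟨a.tdiv q, a.tmod q, (Int.mul_tdiv_add_tmod a q).symm, ?_, ?_⟩
  · simp only [Int.abs_eq_natAbs, Int.natAbs_tdiv]
    exact_mod_cast Nat.mul_div_le a.natAbs q.natAbs
  · simp only [Int.abs_eq_natAbs, Int.natAbs_tmod]
    exact_mod_cast Nat.mod_lt _ (Int.natAbs_pos.mpr hq)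

/-- Every linear polynomial has a reduced form modulo `X² + pX − q`. -/
theorem exists_reduced_of_linear {p q : ℤ} (hpq : 1 + |p| < |q|) (a b : ℤ) :
    ∃ g : ℤ[X], (∀ i, |g.coeff i| < |q|) ∧
      (X ^ 2 + C p * X - C q) ∣ (C b * X + C a - g) := by
  have hp : 0 ≤ |p| := abs_nonneg p
  have hq : 0 < |q| := by linarith
  by_cases h0 : a = 0 ∧ b = 0
  · obtain ⟨rfl, rfl⟩ := h0
    exact ⟨0, by simpa using hq, by simp⟩
  obtain ⟨s, r, rfl, hs, hr⟩ := Int.exists_eq_mul_add_abs_lt a (abs_pos.mp hq)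
  have hdec : 2 * |b + p * s| + 3 * |s| < 2 * |q * s + r| + 3 * |b| := by
    have hadd : |b + p * s| ≤ |b| + |p| * |s| := abs_mul p s ▸ abs_add_le b (p * s)
    have hb : 0 ≤ |b| := abs_nonneg b
    rcases eq_or_ne s 0 with rfl | hs0
    · simp only [mul_zero, zero_add, add_zero, abs_zero] at h0 ⊢
      rcases not_and_or.mp h0 with h | h <;>
      · have := abs_pos.mpr h
        linarith [abs_nonneg r]
    · have := abs_pos.mpr hs0
      nlinarith
  obtain ⟨g, hg, u, hu⟩ := exists_reduced_of_linear hpq (b + p * s) s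
  refine ⟨X * g + C r, fun i => ?_, X * u - C s, ?_⟩
  · cases i with
    | zero => simpa using hr
    | succ n => simpa only [coeff_add, coeff_X_mul, coeff_C_succ, add_zero] using hg n
  · simp only [C_add, C_mul] at hu ⊢
    linear_combination X * hu
termination_by (2 * |a| + 3 * |b|).toNat
decreasing_by
  subst_vars
  have := abs_nonneg (b + p * s)
  have := abs_nonneg s
  lia

/-- Every polynomial has a reduced form modulo `X² + pX − q`. -/
theorem exists_reduced {p q : ℤ} (hpq : 1 + |p| < |q|) (f : ℤ[X]) :
    ∃ g : ℤ[X], (∀ i, |g.coeff i| < |q|) ∧ (X ^ 2 + C p * X - C q) ∣ (f - g) := by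
  have hdeg : (X ^ 2 + C p * X - C q).natDegree = 2 := by compute_degree!
  have hmonic : (X ^ 2 + C p * X - C q).Monic := by monicity!
  have hlt := natDegree_modByMonic_lt f hmonic (fun h => by rw [h, natDegree_one] at hdeg; lia)
  obtain ⟨b, a, hab⟩ := exists_eq_X_add_C_of_natDegree_le_one
    (show (f %ₘ (X ^ 2 + C p * X - C q)).natDegree ≤ 1 by lia)
  obtain ⟨g, hg, hdvd⟩ := exists_reduced_of_linear hpq a b
  refine ⟨g, hg, ?_⟩
  rw [← hab] at hdvd
  have hf := modByMonic_add_div f (X ^ 2 + C p * X - C q)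
  have := dvd_add hdvd (dvd_mul_right _ (f /ₘ (X ^ 2 + C p * X - C q)))
  rwa [sub_add_eq_add_sub, hf] at this

/-- For every `k ≥ 1`, the constant polynomial `q^k` starts with at least `k` zeros
in reduced form modulo `t = X² + pX − q` (with `1 + |p| < |q|`). -/
theorem qpow_starts_with_zeros (p q : ℤ) (hpq : 1 + |p| < |q|) (k : ℕ) (hk : 1 ≤ k) :
    ∃ g : Polynomial ℤ, (∀ i, |g.coeff i| < |q|) ∧ X ^ k ∣ g ∧
      (X ^ 2 + C p * X - C q) ∣ (C (q ^ k) - g) := by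
  obtain ⟨g, hg, hdvd⟩ := exists_reduced hpq ((X + C p) ^ k)
  refine ⟨X ^ k * g, fun i => ?_, dvd_mul_right _ _, ?_⟩
  · rw [coeff_X_pow_mul']
    split_ifs
    · exact hg _
    · rw [abs_zero]
      linarith [abs_nonneg p]
  · have hpow : (X ^ 2 + C p * X - C q) ∣ C q ^ k - (X * (X + C p)) ^ k :=
      dvd_trans ⟨-1, by ring⟩ (sub_dvd_pow_sub_pow (C q) (X * (X + C p)) k)
    convert dvd_add hpow (hdvd.mul_left (X ^ k)) using 1
    rw [C_pow, mul_pow]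
    ring
end

section
/- Let p and q be integers with 1 + |p| < |q| and gcd(p, q) = 1, and let t(x) = x² + px − q. Suppose n = qℓ for an integer ℓ, and n starts with m > 0 zeros in reduced form, i.e., there is a reduced polynomial g ∈ ℤ[x] with x^m ∣ g and t ∣ (n − g). Then ℓ starts with m − 1 zeros in reduced form; precisely, every reduced polynomial f ∈ ℤ[x] with t ∣ (ℓ − f) is divisible by x^{m−1}. -/
open Polynomial

/-- `X` can be cancelled from a factor of a multiple of `X² + pX − q` when `q ≠ 0`. -/
lemma X_dvd_of_X_dvd_quadratic_mul {p q : ℤ} (hq : q ≠ 0) {k : ℤ[X]}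
    (h : X ∣ (X ^ 2 + C p * X - C q) * k) : X ∣ k := by
  rw [X_dvd_iff] at h ⊢
  simpa [mul_coeff_zero, hq] using h

/-- A reduced polynomial lying in the ideal `(X^k, X² + pX − q)` is divisible by `X^k`. -/
lemma X_pow_dvd_of_reduced {p q : ℤ} (hq : q ≠ 0) (k : ℕ) (f : ℤ[X])
    (hf : ∀ i, |f.coeff i| < |q|) (a b : ℤ[X])
    (h : f = X ^ k * a + (X ^ 2 + C p * X - C q) * b) : X ^ k ∣ f := by
  induction k generalizing f b with
  | zero => simp
  | succ k ih =>
    have h0 : f.coeff 0 = 0 := by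
      refine Int.eq_zero_of_abs_lt_dvd (m := |q|) ?_ (hf 0)
      rw [abs_dvd, h]
      simp [mul_coeff_zero, pow_succ]
    obtain ⟨f', rfl⟩ := X_dvd_iff.mpr h0
    obtain ⟨b', rfl⟩ : X ∣ b := by
      refine X_dvd_of_X_dvd_quadratic_mul (p := p) hq ⟨f' - X ^ k * a, ?_⟩
      linear_combination -h
    have h' : f' = X ^ k * a + (X ^ 2 + C p * X - C q) * b' := by
      refine mul_left_cancel₀ (X_ne_zero (R := ℤ)) ?_
      linear_combination h
    rw [pow_succ']
    refine mul_dvd_mul_left X (ih f' (fun i => ?_) b' h')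
    simpa using hf (i + 1)

/-- `X` and `X + p` are coprime modulo `X² + pX − q` when `gcd(p, q) = 1`. -/
lemma isCoprime_root_root_add {p q : ℤ} (hgcd : Int.gcd p q = 1) :
    IsCoprime (AdjoinRoot.mk (X ^ 2 + C p * X - C q) X)
      (AdjoinRoot.mk (X ^ 2 + C p * X - C q) (X + C p)) := by
  obtain ⟨u, v, huv⟩ := Int.isCoprime_iff_gcd_eq_one.mpr hgcd
  refine ⟨AdjoinRoot.mk _ (-C u), AdjoinRoot.mk _ (C u + C v * X), ?_⟩
  rw [← map_mul, ← map_mul, ← map_add, ← map_one (AdjoinRoot.mk _), AdjoinRoot.mk_eq_mk]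
  have huv' : C u * C p + C v * C q = (1 : ℤ[X]) := by
    simpa using congrArg (C : ℤ →+* ℤ[X]) huv
  exact ⟨C v, by linear_combination huv'⟩

/-- If `gcd(p,q) = 1`, `n = qℓ`, and `n` starts with `m > 0` zeros in reduced form modulo
`t = X² + pX − q` (with `1 + |p| < |q|`), then `ℓ` starts with `m − 1` zeros in reduced form:
every reduced polynomial equivalent to `ℓ` is divisible by `X^(m−1)`. -/
theorem quotient_starts_with_fewer_zeros (p q n ℓ : ℤ) (hpq : 1 + |p| < |q|)
    (hgcd : Int.gcd p q = 1) (hn : n = q * ℓ) (m : ℕ) (hm : 0 < m)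
    (h : ∃ g : Polynomial ℤ, (∀ i, |g.coeff i| < |q|) ∧ X ^ m ∣ g ∧
      (X ^ 2 + C p * X - C q) ∣ (C n - g)) :
    ∀ f : Polynomial ℤ, (∀ i, |f.coeff i| < |q|) →
      (X ^ 2 + C p * X - C q) ∣ (C ℓ - f) → X ^ (m - 1) ∣ f := by
  have hq : q ≠ 0 := by
    rintro rfl
    have := abs_nonneg p
    rw [abs_zero] at hpq
    linarith
  obtain ⟨k, rfl⟩ : ∃ k, m = k + 1 := ⟨m - 1, by omega⟩
  obtain ⟨_, -, ⟨g, rfl⟩, c, hc⟩ := h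
  rintro f hf ⟨d, hd⟩
  rw [Nat.add_sub_cancel]
  rw [hn, C_mul] at hc
  obtain ⟨e, he⟩ : X ∣ c + C ℓ := by
    refine X_dvd_of_X_dvd_quadratic_mul (p := p) hq ⟨(X + C p) * C ℓ - X ^ k * g, ?_⟩
    linear_combination -hc
  have hmul : (X + C p) * C ℓ - X ^ k * g = (X ^ 2 + C p * X - C q) * e := by
    refine mul_left_cancel₀ (X_ne_zero (R := ℤ)) ?_
    linear_combination hc + (X ^ 2 + C p * X - C q) * he
  have hdvd : AdjoinRoot.mk (X ^ 2 + C p * X - C q) X ^ k ∣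
      AdjoinRoot.mk (X ^ 2 + C p * X - C q) (C ℓ) := by
    refine ((isCoprime_root_root_add hgcd).pow_left (m := k)).dvd_of_dvd_mul_left
      ⟨AdjoinRoot.mk _ g, ?_⟩
    rw [← map_mul, ← map_pow, ← map_mul, AdjoinRoot.mk_eq_mk]
    exact ⟨e, hmul⟩
  obtain ⟨y, hy⟩ := hdvd
  obtain ⟨a, rfl⟩ := AdjoinRoot.mk_surjective y
  rw [← map_pow, ← map_mul, AdjoinRoot.mk_eq_mk] at hy
  obtain ⟨b, hb⟩ := hy
  exact X_pow_dvd_of_reduced (p := p) hq k f hf a (b - d) (by linear_combination hb - hd)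
end

section
/- Let p and q be integers with 1 + |p| < |q| and gcd(p, q) = 1, and let t(x) = x² + px − q. If an integer n starts with m zeros in reduced form — i.e., there exists a reduced polynomial g ∈ ℤ[x] (all coefficients of absolute value at most |q| − 1) with x^m ∣ g and t ∣ (n − g) in ℤ[x] — then q^m divides n. -/
open Polynomial

/-- If a monic nonconstant integer polynomial divides `n - c * b`, then `c` divides `n`. -/
lemma dvd_of_monic_dvd_C_sub_C_mul {t b : ℤ[X]} {n c : ℤ} (ht : t.Monic)
    (hdeg : 0 < t.degree) (h : t ∣ C n - C c * b) : c ∣ n := by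
  have h0 := (modByMonic_eq_zero_iff_dvd ht).2 h
  rw [sub_modByMonic, (modByMonic_eq_self_iff ht).2 (degree_C_le.trans_lt hdeg),
    ← smul_eq_C_mul, smul_modByMonic, sub_eq_zero] at h0
  refine ⟨(b %ₘ t).coeff 0, ?_⟩
  simpa using congrArg (fun f => coeff f 0) h0

/-- If `gcd(p,q) = 1` and an integer `n` starts with `m` zeros in reduced form modulo
`t = X² + pX − q` (with `1 + |p| < |q|`), then `q^m` divides `n`. -/
theorem starts_with_zeros_imp_pow_dvd (p q n : ℤ) (hpq : 1 + |p| < |q|)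
    (hgcd : Int.gcd p q = 1) (m : ℕ)
    (h : ∃ g : Polynomial ℤ, (∀ i, |g.coeff i| < |q|) ∧ X ^ m ∣ g ∧
      (X ^ 2 + C p * X - C q) ∣ (C n - g)) :
    q ^ m ∣ n := by
  obtain ⟨g, -, ⟨a, rfl⟩, f, hf⟩ := h
  set t : ℤ[X] := X ^ 2 + C p * X - C q with ht
  have hdeg : t.degree = 2 := by rw [ht]; compute_degree!
  have hmonic : t.Monic := by rw [ht]; monicity!
  have hconj : t.comp (-X - C p) = t := by
    simp only [ht, sub_comp, add_comp, mul_comp, pow_comp, X_comp, C_comp]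
    ring
  have hf' := congrArg (fun r => r.comp (-X - C p)) hf
  simp only [sub_comp, mul_comp, pow_comp, X_comp, C_comp, hconj] at hf'
  let φ := AdjoinRoot.mk t
  have hφt : φ t = 0 := AdjoinRoot.mk_self
  have hx : φ X ^ m ∣ φ (C n) := by
    refine ⟨φ a, ?_⟩
    have := congrArg φ hf
    rwa [map_mul, hφt, zero_mul, map_sub, sub_eq_zero, map_mul, map_pow] at this
  have hy : φ (-X - C p) ^ m ∣ φ (C n) := by
    refine ⟨φ (a.comp (-X - C p)), ?_⟩
    have := congrArg φ hf'
    rwa [map_mul, hφt, zero_mul, map_sub, sub_eq_zero, map_mul, map_pow] at this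
  have hprod : φ X * φ (-X - C p) = -φ (C q) := by
    rw [← map_mul, ← map_neg, ← sub_eq_zero, ← map_sub,
      show X * (-X - C p) - -C q = -t by rw [ht]; ring, map_neg, hφt, neg_zero]
  have hcop : IsCoprime (φ X) (φ (-X - C p)) := by
    obtain ⟨u, v, huv⟩ := Int.isCoprime_iff_gcd_eq_one.2 hgcd
    have key := congrArg (fun z => φ (C z)) huv
    simp only [map_add, map_mul, map_one] at key
    refine ⟨-φ (C u) - φ (C v) * φ (-X - C p), -φ (C u), ?_⟩
    rw [← key]
    have hp : φ (-X - C p) = -φ X - φ (C p) := by simp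
    linear_combination (-φ (C v)) * hprod - φ (C u) * hp
  obtain ⟨b, hb⟩ := hcop.pow (m := m) (n := m) |>.mul_dvd hx hy
  obtain ⟨b, rfl⟩ := AdjoinRoot.mk_surjective b
  have hdvd : t ∣ C n - C (q ^ m) * (C ((-1) ^ m) * b) := by
    rw [← AdjoinRoot.mk_eq_mk]
    change φ _ = φ _
    rw [hb, ← mul_pow, hprod, neg_pow]
    simp only [map_mul, map_pow, map_neg, map_one]
    change (-1) ^ m * φ (C q) ^ m * φ b = _
    ring
  exact dvd_of_monic_dvd_C_sub_C_mul hmonic (by rw [hdeg]; norm_num) hdvd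
end

section
/- Fix integers p, q with 1 + |p| < |q| and gcd(p, q) = 1, and let t = x² + px − q ∈ ℤ[x]. Then the language L_ξ = { w ∈ Dom_{p,q} : there exists k ∈ ℤ with t ∣ (P(w) − k) } is not a regular language. (Equivalently, the cyclic component ⟨ξ⟩ of ℤ², where ξ is the class of the constant polynomial 1, is not FA-recognizable with respect to the Nies–Semukhin presentation ψ_{p,q}.) -/
open Polynomial

/-- The alphabet `Σ_q`: integers of absolute value at most `|q| − 1`. -/
def NSAlph (q : ℤ) : Type := {a : ℤ // |a| < |q|}

/-- The polynomial `P(w) = a₀ + a₁x + ⋯ + a_nxⁿ` represented by the string `w = a₀a₁…a_n`. -/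
noncomputable def NSpoly {q : ℤ} : List (NSAlph q) → Polynomial ℤ
  | [] => 0
  | a :: w => C a.val + X * NSpoly w

/-- Two strings are equivalent if `t = X² + pX − q` divides the difference of the
polynomials they represent. -/
def NSequiv (p q : ℤ) (u v : List (NSAlph q)) : Prop :=
  (X ^ 2 + C p * X - C q) ∣ (NSpoly u - NSpoly v)

/-- The length-lexicographic order on strings over `Σ_q`. -/
def NSllex {q : ℤ} (u v : List (NSAlph q)) : Prop :=
  u.length < v.length ∨
    (u.length = v.length ∧ List.Lex (fun a b : NSAlph q => a.val < b.val) u v)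

/-- The domain of the Nies–Semukhin presentation `ψ_{p,q}`: strings that are
length-lexicographically minimal in their equivalence class. -/
def NSDom (p q : ℤ) : Language (NSAlph q) :=
  { w | ∀ u, NSllex u w → ¬ NSequiv p q u w }

instance {q : ℤ} : Finite (NSAlph q) :=
  ((Set.finite_Icc (-|q|) |q|).subset fun a (ha : |a| < |q|) => by
    have := abs_lt.mp ha
    exact ⟨by linarith, by linarith⟩ : Set.Finite {a : ℤ | |a| < |q|}).to_subtype

theorem NSpoly_append {q : ℤ} (u v : List (NSAlph q)) :
    NSpoly (u ++ v) = NSpoly u + X ^ u.length * NSpoly v := by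
  induction u with
  | nil => simp [NSpoly]
  | cons a u ih =>
    simp only [List.cons_append, NSpoly, ih, List.length_cons]
    ring

/-- The quadratic `X² + pX − q` divides a linear polynomial only if the latter vanishes. -/
theorem eq_zero_of_quadratic_dvd_linear {p q a b : ℤ}
    (h : (X ^ 2 + C p * X - C q) ∣ (C a * X + C b)) : a = 0 ∧ b = 0 := by
  have hm : (X ^ 2 + C p * X - C q).Monic := by monicity!
  have hd : (X ^ 2 + C p * X - C q).degree = 2 := by compute_degree!
  have h0 : (C a * X + C b : ℤ[X]) = 0 := by
    refine eq_zero_of_dvd_of_degree_lt h ?_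
    rw [hd]
    exact degree_linear_le.trans_lt (by norm_num)
  exact ⟨by simpa [-eq_intCast] using congrArg (coeff · 1) h0,
    by simpa using congrArg (coeff · 0) h0⟩

/-- Modulo `X² + pX − q`, the power `X ^ (d + 1)` is linear, with leading coefficient congruent
to `(-p) ^ d` modulo `q`. -/
theorem exists_pow_reduction (p q : ℤ) (d : ℕ) :
    ∃ r s : ℤ, (X ^ 2 + C p * X - C q) ∣ (X ^ (d + 1) - (C s * X + C r)) ∧
      q ∣ s - (-p) ^ d ∧ q ∣ r := by
  induction d with
  | zero => exact ⟨0, 1, by simp, by simp, by simp⟩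
  | succ d ih =>
    obtain ⟨r, s, ht, hs, hr⟩ := ih
    refine ⟨q * s, r - p * s, ?_, ?_, dvd_mul_right q s⟩
    · have : (X ^ (d + 1 + 1) - (C (r - p * s) * X + C (q * s)) : ℤ[X]) =
          (X ^ (d + 1) - (C s * X + C r)) * X + (X ^ 2 + C p * X - C q) * C s := by
        simp only [C_sub, C_mul]
        ring
      rw [this]
      exact dvd_add (ht.mul_right X) (dvd_mul_right _ _)
    · have : r - p * s - (-p) ^ (d + 1) = r + (s - (-p) ^ d) * (-p) := by ring
      rw [this]
      exact dvd_add hr (hs.mul_right _)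

/-- No positive power of `X` is rational modulo `X² + pX − q`. -/
theorem eq_zero_of_quadratic_dvd_pow_mul_sub {p q : ℤ} (hq : 1 < |q|) (hgcd : Int.gcd p q = 1)
    {d : ℕ} {m k : ℤ} (h : (X ^ 2 + C p * X - C q) ∣ (X ^ (d + 1) * C m - C k)) : k = 0 := by
  obtain ⟨r, s, ht, hs, -⟩ := exists_pow_reduction p q d
  have hlin : (X ^ 2 + C p * X - C q) ∣ (C (m * s) * X + C (m * r - k)) := by
    have : (C (m * s) * X + C (m * r - k) : ℤ[X]) =
        (X ^ (d + 1) * C m - C k) - (X ^ (d + 1) - (C s * X + C r)) * C m := by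
      simp only [C_sub, C_mul]
      ring
    rw [this]
    exact dvd_sub h (ht.mul_right _)
  obtain ⟨hms, hmr⟩ := eq_zero_of_quadratic_dvd_linear hlin
  have hs0 : s ≠ 0 := by
    rintro rfl
    have hdvd : q ∣ (-p) ^ d := by simpa using hs
    have hcop : IsCoprime ((-p) ^ d) q :=
      ((Int.isCoprime_iff_gcd_eq_one.mpr hgcd).neg_left).pow_left
    have hunit : |q| = 1 := Int.isUnit_iff_abs_eq.mp (hcop.symm.isUnit_of_dvd hdvd)
    omega
  have hm : m = 0 := (mul_eq_zero.mp hms).resolve_right hs0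
  subst hm
  linarith

/-- Every linear polynomial is represented by a string modulo `X² + pX − q`. -/
theorem exists_NSpoly_linear {p q : ℤ} (hpq : 1 + |p| < |q|) (a b : ℤ) :
    ∃ w : List (NSAlph q), (X ^ 2 + C p * X - C q) ∣ (NSpoly w - (C b * X + C a)) := by
  induction hn : 2 * (|a| + |b|).toNat + (if a = 0 then 1 else 0) using Nat.strong_induction_on
    generalizing a b with
  | _ n ih =>
  by_cases h0 : a = 0 ∧ b = 0
  · exact ⟨[], by simp [h0, NSpoly]⟩
  have hq : q ≠ 0 := by
    rintro rfl
    have := abs_nonneg p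
    simp at hpq
    linarith
  set c := a.tdiv q with hc
  have hdiv : (C a : ℤ[X]) = C (a.tmod q) + C q * C c := by
    rw [← C_mul, ← C_add, Int.tmod_add_mul_tdiv]
  have hrem : |a.tmod q| < |q| := by
    rw [Int.abs_eq_natAbs, Int.abs_eq_natAbs, Int.natAbs_tmod]
    exact_mod_cast Nat.mod_lt _ (Int.natAbs_pos.mpr hq)
  have hquot : |q| * |c| ≤ |a| := by
    rw [hc, Int.abs_eq_natAbs, Int.abs_eq_natAbs, Int.abs_eq_natAbs, Int.natAbs_tdiv]
    exact_mod_cast Nat.mul_div_le _ _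
  have hcarry : |b + p * c| ≤ |b| + |p| * |c| := by
    rw [← abs_mul]
    exact abs_add_le _ _
  have hlt : 2 * (|b + p * c| + |c|).toNat + (if b + p * c = 0 then 1 else 0) < n := by
    by_cases ha : a = 0
    · have hc0 : c = 0 := by simp [hc, ha]
      have hb : b ≠ 0 := fun hb => h0 ⟨ha, hb⟩
      simp only [ha, hc0] at hn ⊢
      simp [hb] at hn ⊢
      omega
    · have hdec : |b + p * c| + |c| < |a| + |b| := by
        rcases eq_or_ne c 0 with hc0 | hc0
        · have := abs_pos.mpr ha
          simp only [hc0, mul_zero, add_zero, abs_zero]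
          linarith
        · nlinarith [abs_pos.mpr hc0]
      have h1 := abs_nonneg (b + p * c)
      have h2 := abs_nonneg c
      rw [if_neg ha] at hn
      split_ifs <;> omega
  obtain ⟨w, hw⟩ := ih _ hlt (b + p * c) c rfl
  refine ⟨(⟨a.tmod q, hrem⟩ : NSAlph q) :: w, ?_⟩
  have : NSpoly ((⟨a.tmod q, hrem⟩ : NSAlph q) :: w) - (C b * X + C a) =
      (NSpoly w - (C c * X + C (b + p * c))) * X + (X ^ 2 + C p * X - C q) * C c := by
    simp only [NSpoly, C_add, C_mul]
    linear_combination -hdiv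
  rw [this]
  exact dvd_add (hw.mul_right X) (dvd_mul_right _ _)

theorem NSllex_wellFounded (q : ℤ) : WellFounded (NSllex (q := q)) := by
  have : IsTrans (NSAlph q) fun a b => a.val < b.val := ⟨fun _ _ _ => lt_trans⟩
  have : Std.Irrefl fun a b : NSAlph q => a.val < b.val := ⟨fun _ => lt_irrefl _⟩
  have hwf : WellFounded fun a b : NSAlph q => a.val < b.val :=
    Finite.wellFounded_of_trans_of_irrefl _
  exact Subrelation.wf (fun {u v} h => List.shortlex_def.mpr h) (List.Shortlex.wf hwf)

/-- Every string is equivalent to one in the domain. -/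
theorem exists_mem_NSDom_equiv {p q : ℤ} (w : List (NSAlph q)) :
    ∃ v ∈ NSDom p q, NSequiv p q v w := by
  obtain ⟨v, hv, hmin⟩ :=
    (NSllex_wellFounded q).has_min {v | NSequiv p q v w} ⟨w, by simp [NSequiv]⟩
  refine ⟨v, fun u hu huv => hmin u ?_ hu, hv⟩
  have := dvd_add huv hv
  rwa [sub_add_sub_cancel] at this

/-- Nies–Semukhin: for `1 + |p| < |q|` and `gcd(p,q) = 1`, the language of strings in
`Dom_{p,q}` representing elements of the cyclic subgroup `⟨ξ⟩` generated by the class of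
the constant polynomial `1` is not regular. -/
theorem L_xi_not_regular (p q : ℤ) (hpq : 1 + |p| < |q|) (hgcd : Int.gcd p q = 1) :
    ¬ Language.IsRegular
      { w ∈ NSDom p q | ∃ k : ℤ, (X ^ 2 + C p * X - C q) ∣ (NSpoly w - C k) } := by
  rintro ⟨σ, _, M, hM⟩
  have hq : 1 < |q| := by linarith [abs_nonneg p]
  have hrep : ∀ k : ℤ, ∃ w ∈ NSDom p q, (X ^ 2 + C p * X - C q) ∣ (NSpoly w - C k) := by
    intro k
    obtain ⟨w, hw⟩ := exists_NSpoly_linear hpq k 0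
    obtain ⟨v, hv, hvw⟩ := exists_mem_NSDom_equiv (p := p) w
    refine ⟨v, hv, ?_⟩
    have := dvd_add hvw hw
    simpa using this
  choose w hdom hw using hrep
  have hmem : ∀ v, v ∈ M.accepts ↔
      v ∈ NSDom p q ∧ ∃ k : ℤ, (X ^ 2 + C p * X - C q) ∣ (NSpoly v - C k) := by
    intro v
    rw [hM]
    rfl
  set N := Fintype.card σ
  have : Finite {l : List (NSAlph q) // l.length ≤ N} := (List.finite_length_le _ N).to_subtype
  obtain ⟨k, k', hne, htake⟩ := Finite.exists_ne_map_eq_of_infinite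
    fun k : ℤ => (⟨(w k).take N, by simp⟩ : {l : List (NSAlph q) // l.length ≤ N})
  replace htake : (w k).take N = (w k').take N := congrArg Subtype.val htake
  have hsub {f : ℤ[X]} {g : ℤ[X]} {i j : ℤ} (hf : (X ^ 2 + C p * X - C q) ∣ (f - C i))
      (hg : (X ^ 2 + C p * X - C q) ∣ (g - C j)) :
      (X ^ 2 + C p * X - C q) ∣ (f - g - C (i - j)) := by
    have := dvd_sub hf hg
    rwa [sub_sub_sub_comm, ← C_sub] at this
  have hlen : N ≤ ((w k).take N).length := by
    by_contra! hlt
    have hk : (w k).length < N := by simpa using hlt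
    have hk' : (w k').length < N := by simpa [htake] using hlt
    rw [List.take_of_length_le hk.le, List.take_of_length_le hk'.le] at htake
    have h := hsub (hw k) (hw k')
    rw [htake] at h
    have h' : (X ^ 2 + C p * X - C q) ∣ (C 0 * X + C (k - k')) := by
      have := (dvd_neg (α := ℤ[X])).mpr h
      simpa using this
    exact hne (sub_eq_zero.mp (eq_zero_of_quadratic_dvd_linear h').2)
  obtain ⟨s, a, b, c, habc, -, hb, ha, hs, -⟩ := M.evalFrom_split (s := M.start) hlen rfl
  have hpump : ∀ i : ℤ, (w i).take N = (w k).take N →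
      ∃ v, w i = a ++ b ++ v ∧ a ++ v ∈ M.accepts := by
    intro i hi
    refine ⟨c ++ (w i).drop N, ?_, ?_⟩
    · rw [← List.append_assoc, ← habc, ← hi, List.take_append_drop]
    · have hacc := (hmem (w i)).mpr ⟨hdom i, i, hw i⟩
      rw [← List.take_append_drop N (w i), hi, habc] at hacc
      rw [DFA.mem_accepts, DFA.eval] at hacc ⊢
      simpa only [DFA.evalFrom_of_append, ha, hs] using hacc
  obtain ⟨v, hv, hav⟩ := hpump k rfl
  obtain ⟨v', hv', hav'⟩ := hpump k' htake.symm
  obtain ⟨m, hm⟩ := ((hmem _).mp hav).2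
  obtain ⟨m', hm'⟩ := ((hmem _).mp hav').2
  have hshort := hsub hm hm'
  have hlong := hsub (hw k) (hw k')
  obtain ⟨d, hd⟩ := Nat.exists_eq_succ_of_ne_zero (List.length_pos_iff.mpr hb).ne'
  rw [hv, hv'] at hlong
  simp only [NSpoly_append, List.length_append, hd] at hshort hlong
  refine hne (sub_eq_zero.mp
    (eq_zero_of_quadratic_dvd_pow_mul_sub (d := d) (m := m - m') hq hgcd ?_))
  convert dvd_sub hlong (hshort.mul_left (X ^ (d + 1))) using 1
  simp only [Nat.succ_eq_add_one]
  ring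
end

section
/- Fix integers p, q with 1 + |p| < |q| and gcd(p, q) = 1, and suppose t = x² + px − q is irreducible in ℤ[x]. Then for every polynomial g ∈ ℤ[x] not divisible by t, the language L_γ = { w ∈ Dom_{p,q} : there exists k ∈ ℤ with t ∣ (P(w) − k·g) } is not regular. (Equivalently, no nontrivial cyclic subgroup of ℤ² is FA-recognizable with respect to ψ_{p,q}.) -/
open Polynomial

/-- The ring `ℤ[X]/(X² + pX − q)`. -/
abbrev NSRing (p q : ℤ) : Type := AdjoinRoot (X ^ 2 + C p * X - C q : Polynomial ℤ)

/-- The class of `X` in `ℤ[X]/(X² + pX − q)`. -/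
noncomputable abbrev NSroot (p q : ℤ) : NSRing p q := AdjoinRoot.root _

/-- The class in `ℤ[X]/(X² + pX − q)` represented by the string `w`. -/
noncomputable def NSval (p q : ℤ) (w : List (NSAlph q)) : NSRing p q :=
  AdjoinRoot.mk _ (NSpoly w)

theorem NSequiv_iff {p q : ℤ} {u v : List (NSAlph q)} :
    NSequiv p q u v ↔ NSval p q u = NSval p q v :=
  AdjoinRoot.mk_eq_mk.symm

theorem NSval_append (p : ℤ) {q : ℤ} (u v : List (NSAlph q)) :
    NSval p q (u ++ v) = NSval p q u + NSroot p q ^ u.length * NSval p q v := by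
  simp [NSval, NSpoly_append]

theorem NSval_cons (p : ℤ) {q : ℤ} (a : NSAlph q) (v : List (NSAlph q)) :
    NSval p q (a :: v) = (a.val : NSRing p q) + NSroot p q * NSval p q v := by
  simp [NSval, NSpoly]

theorem NSroot_sq (p q : ℤ) : NSroot p q ^ 2 = q - p * NSroot p q := by
  have h := AdjoinRoot.mk_self (f := X ^ 2 + C p * X - C q)
  simp only [map_sub, map_add, map_mul, map_pow, AdjoinRoot.mk_X, eq_intCast, map_intCast] at h
  linear_combination h

/-- `1` and the root of `X² + pX − q` are linearly independent over `ℤ`. -/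
theorem coeff_eq_zero_of_add_mul_root_eq_zero {p q a b : ℤ}
    (h : (a : NSRing p q) + b * NSroot p q = 0) : a = 0 ∧ b = 0 := by
  have hdvd : (X ^ 2 + C p * X - C q) ∣ C b * X + C a := by
    rw [← AdjoinRoot.mk_eq_zero, ← h]
    simp [add_comm]
  have hdeg : (X ^ 2 + C p * X - C q).degree = 2 := by compute_degree!
  have hmonic : (X ^ 2 + C p * X - C q).Monic := by monicity!
  have hzero : C b * X + C a = 0 := by
    by_contra hne
    refine hmonic.not_dvd_of_degree_lt hne ?_ hdvd
    rw [hdeg]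
    exact degree_linear_le.trans_lt (by norm_num)
  constructor
  · simpa using congrArg (coeff · 0) hzero
  · simpa [-eq_intCast, coeff_C] using congrArg (coeff · 1) hzero

theorem exists_root_pow_eq (p q : ℤ) (m : ℕ) :
    ∃ a b : ℤ, NSroot p q ^ (m + 1) = (q * a : ℤ) + ((-p) ^ m + q * b : ℤ) * NSroot p q := by
  induction m with
  | zero => exact ⟨0, 0, by simp⟩
  | succ m ih =>
    obtain ⟨a, b, h⟩ := ih
    refine ⟨(-p) ^ m + q * b, a - p * b, ?_⟩
    rw [pow_succ, h]
    push_cast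
    linear_combination ((-p) ^ m + q * b : NSRing p q) * NSroot_sq p q

/-- No positive power of the root of `X² + pX − q` is rational. -/
theorem eq_zero_of_mul_root_pow_eq {p q : ℤ} (hq : 1 < |q|) (hgcd : Int.gcd p q = 1)
    {m : ℕ} (hm : m ≠ 0) {i j : ℤ}
    (h : (i : NSRing p q) * NSroot p q ^ m = j) : i = 0 := by
  obtain ⟨m, rfl⟩ := Nat.exists_eq_succ_of_ne_zero hm
  obtain ⟨a, b, hab⟩ := exists_root_pow_eq p q m
  rw [Nat.succ_eq_add_one, hab] at h
  have hcoeff := (coeff_eq_zero_of_add_mul_root_eq_zero (p := p) (q := q)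
    (a := i * (q * a) - j) (b := i * ((-p) ^ m + q * b)) (by
      push_cast at h ⊢
      linear_combination h)).2
  refine (mul_eq_zero.1 hcoeff).resolve_right fun hzero => ?_
  have hdvd : q ∣ (-p) ^ m := ⟨-b, by linear_combination hzero⟩
  have hcop : IsCoprime q ((-p) ^ m) :=
    (Int.isCoprime_iff_gcd_eq_one.2 hgcd).symm.neg_right.pow_right
  have := Int.isUnit_iff_abs_eq.1 (hcop.isUnit_of_dvd' dvd_rfl hdvd)
  omega

/-- Every class modulo `X² + pX − q` is represented by a string. -/
theorem exists_NSval_eq {p q : ℤ} (hpq : 1 + |p| < |q|) (c d : ℤ) :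
    ∃ w, NSval p q w = c + d * NSroot p q := by
  by_cases hzero : c = 0 ∧ d = 0
  · exact ⟨[], by simp [hzero.1, hzero.2, NSval, NSpoly]⟩
  have hq : q ≠ 0 := abs_pos.1 (by have := abs_nonneg p; omega)
  obtain ⟨w, hw⟩ := exists_NSval_eq hpq (d + p * c.tdiv q) (c.tdiv q)
  have hr : |c.tmod q| < |q| := by
    rw [Int.abs_eq_natAbs, Int.abs_eq_natAbs, Int.natAbs_tmod]
    exact_mod_cast Nat.mod_lt _ (Int.natAbs_pos.2 hq)
  obtain ⟨r, hr⟩ : ∃ r : NSAlph q, r.val = c.tmod q := ⟨⟨_, hr⟩, rfl⟩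
  refine ⟨r :: w, ?_⟩
  have h : (c : NSRing p q) = c.tmod q + q * c.tdiv q := by
    rw [← Int.cast_mul, ← Int.cast_add, Int.tmod_add_mul_tdiv]
  rw [NSval_cons, hr, hw, h]
  push_cast
  linear_combination (c.tdiv q : NSRing p q) * NSroot_sq p q
termination_by 2 * (c.natAbs + d.natAbs) + if c = 0 then 1 else 0
decreasing_by
  by_cases hc : c = 0
  · subst hc
    have hd : d ≠ 0 := by tauto
    simp [hd]
  · have hdiv : |q| * |c.tdiv q| ≤ |c| := by
      rw [Int.abs_eq_natAbs, Int.abs_eq_natAbs, Int.abs_eq_natAbs, Int.natAbs_tdiv]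
      exact_mod_cast Nat.mul_div_le _ _
    have hadd : |d + p * c.tdiv q| ≤ |d| + |p| * |c.tdiv q| := by
      rw [← abs_mul]; exact abs_add_le _ _
    have hlt : |d + p * c.tdiv q| + |c.tdiv q| < |c| + |d| := by
      have hcpos := abs_pos.2 hc
      rcases (abs_nonneg (c.tdiv q)).eq_or_lt with h | h
      · rw [← h] at hadd ⊢
        omega
      · nlinarith
    zify
    split_ifs <;> linarith

theorem exists_eq_add_mul_root {p q : ℤ} (y : NSRing p q) :
    ∃ c d : ℤ, y = c + d * NSroot p q := by
  induction y using AdjoinRoot.induction_on with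
  | ih f =>
    induction f using Polynomial.induction_on' with
    | add f g hf hg =>
      obtain ⟨a, b, hf⟩ := hf
      obtain ⟨c, d, hg⟩ := hg
      refine ⟨a + c, b + d, ?_⟩
      rw [map_add, hf, hg]
      push_cast
      ring
    | monomial n a =>
      cases n with
      | zero => exact ⟨a, 0, by simp⟩
      | succ n =>
        obtain ⟨b, c, h⟩ := exists_root_pow_eq p q n
        refine ⟨a * (q * b), a * ((-p) ^ n + q * c), ?_⟩
        rw [← C_mul_X_pow_eq_monomial, map_mul, map_pow, AdjoinRoot.mk_X, h,
          eq_intCast (C : ℤ →+* ℤ[X]) a, map_intCast]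
        push_cast
        ring

theorem NSllex_eq_shortlex {q : ℤ} :
    (NSllex : List (NSAlph q) → List (NSAlph q) → Prop) =
      List.Shortlex fun a b => a.val < b.val := by
  ext u v
  rw [List.shortlex_def]
  rfl

instance NSAlph.finite (q : ℤ) : Finite (NSAlph q) :=
  ((Set.finite_Ioo (-|q|) |q|).subset fun _ h => abs_lt.1 h).to_subtype

theorem NSllex_wellFounded_s12 (q : ℤ) :
    WellFounded (NSllex : List (NSAlph q) → List (NSAlph q) → Prop) := by
  rw [NSllex_eq_shortlex]
  have : IsTrans (NSAlph q) fun a b => a.val < b.val := ⟨fun _ _ _ => lt_trans⟩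
  have : Std.Irrefl fun a b : NSAlph q => a.val < b.val := ⟨fun _ => lt_irrefl _⟩
  exact List.Shortlex.wf (Finite.wellFounded_of_trans_of_irrefl _)

theorem exists_mem_NSDom_NSval_eq {p q : ℤ} (v : List (NSAlph q)) :
    ∃ w ∈ NSDom p q, NSval p q w = NSval p q v := by
  obtain ⟨w, hw, hmin⟩ := (NSllex_wellFounded_s12 q).has_min
    {w | NSval p q w = NSval p q v} ⟨v, rfl⟩
  exact ⟨w, fun u hu he => hmin u ((NSequiv_iff.1 he).trans hw) hu, hw⟩

/-- If `t = X² + pX − q` is irreducible (with `1 + |p| < |q|`, `gcd(p,q) = 1`), then for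
every polynomial `g` not divisible by `t`, the language of strings in `Dom_{p,q}`
representing elements of the cyclic subgroup generated by the class of `g` is not regular. -/
theorem L_gamma_not_regular (p q : ℤ) (hpq : 1 + |p| < |q|) (hgcd : Int.gcd p q = 1)
    (hirr : Irreducible (X ^ 2 + C p * X - C q)) (g : Polynomial ℤ)
    (hg : ¬ (X ^ 2 + C p * X - C q) ∣ g) :
    ¬ Language.IsRegular
      { w ∈ NSDom p q | ∃ k : ℤ, (X ^ 2 + C p * X - C q) ∣ (NSpoly w - C k * g) } := by
  have := AdjoinRoot.isDomain_of_prime hirr.prime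
  set γ := AdjoinRoot.mk (X ^ 2 + C p * X - C q) g with hγ
  have hγ0 : γ ≠ 0 := fun h => hg (AdjoinRoot.mk_eq_zero.1 h)
  have hmem (w : List (NSAlph q)) (k : ℤ) :
      (X ^ 2 + C p * X - C q) ∣ (NSpoly w - C k * g) ↔ NSval p q w = k * γ := by
    rw [← AdjoinRoot.mk_eq_mk]
    simp [NSval, hγ]
  simp only [hmem]
  have hchar (k : ℤ) : (k : NSRing p q) = 0 → k = 0 := fun h =>
    (coeff_eq_zero_of_add_mul_root_eq_zero (p := p) (q := q) (b := 0) (by simpa using h)).1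
  have hex (k : ℤ) : ∃ w ∈ NSDom p q, NSval p q w = k * γ := by
    obtain ⟨c, d, hcd⟩ := exists_eq_add_mul_root (k * γ : NSRing p q)
    obtain ⟨v, hv⟩ := exists_NSval_eq hpq c d
    obtain ⟨w, hw, hwv⟩ := exists_mem_NSDom_NSval_eq v
    exact ⟨w, hw, hwv.trans (hv.trans hcd.symm)⟩
  choose f hfdom hfval using hex
  have hinj : Function.Injective f := fun i j hij => by
    have h := hfval i
    rw [hij, hfval j] at h
    have := hchar (j - i) (by push_cast; linear_combination mul_right_cancel₀ hγ0 h)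
    omega
  rintro ⟨σ, _, M, hM⟩
  obtain ⟨k, hk⟩ : ∃ k, Fintype.card σ ≤ (f k).length := by
    by_contra! hlt
    exact Set.infinite_range_of_injective hinj
      ((List.finite_length_lt _ (Fintype.card σ)).subset (Set.range_subset_iff.2 hlt))
  obtain ⟨u, v, z, -, -, hv, hpump⟩ :=
    M.pumping_lemma (hM ▸ ⟨hfdom k, k, hfval k⟩ : f k ∈ M.accepts) hk
  rw [hM] at hpump
  have hword (n : ℕ) : u ++ (List.replicate n v).flatten ++ z ∈ NSDom p q ∧
      ∃ k : ℤ, NSval p q (u ++ (List.replicate n v).flatten ++ z) = k * γ :=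
    hpump (Language.append_mem_mul (Language.append_mem_mul rfl
      (Language.mem_kstar.2 ⟨_, rfl, fun y hy => List.eq_of_mem_replicate hy⟩)) rfl)
  obtain ⟨-, k₀, h₀⟩ := hword 0
  obtain ⟨hdom, k₁, h₁⟩ := hword 1
  obtain ⟨-, k₂, h₂⟩ := hword 2
  have hne : k₁ - k₀ ≠ 0 := fun h => by
    refine hdom (u ++ z) (Or.inl ?_) (NSequiv_iff.2 ?_)
    · have := List.length_pos_of_ne_nil hv
      simp
      omega
    · rw [h₁, sub_eq_zero.1 h, ← h₀]
      simp
  refine hne (eq_zero_of_mul_root_pow_eq (by have := abs_nonneg p; omega) hgcd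
    (List.length_eq_zero_iff.not.2 hv) (j := k₂ - k₁) (mul_right_cancel₀ hγ0 ?_))
  simp [List.replicate, NSval_append] at h₀ h₁ h₂
  push_cast
  linear_combination (NSroot p q ^ v.length) * (h₀ - h₁) + (h₂ - h₁)
end

section
/- Suppose p, q, a, c are integers with 1 + |p| < |q|, gcd(p, q) = 1, p² + 4q = −4, a ≠ 0, and c² − (p² + 4q)a² = 4 or −4. Then there is an even integer r with |r| ≥ 4 such that p = 2r and q = −(r² + 1), and (a, c) = (1, 0) or (a, c) = (−1, 0); consequently the matrix [[(c − ap)/2, a], [aq, (c + ap)/2]] equals ±[[−r, 1], [−(r² + 1), r]]. -/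
/-- The case `n = p² + 4q = −4` of the classification: the solutions with `1 + |p| < |q|`,
`gcd(p, q) = 1`, `a ≠ 0` and `c² − (p² + 4q)a² = ±4` have `p = 2r`, `q = −(r² + 1)` for an
even `r` with `|r| ≥ 4`, with `(a, c) = (±1, 0)`, and the corresponding matrix is
`±[[−r, 1], [−(r² + 1), r]]`. -/
theorem classification_n_neg_four (p q a c : ℤ) (hpq : 1 + |p| < |q|)
    (hgcd : Int.gcd p q = 1) (hn : p ^ 2 + 4 * q = -4) (ha : a ≠ 0)
    (hc : c ^ 2 - (p ^ 2 + 4 * q) * a ^ 2 = 4 ∨ c ^ 2 - (p ^ 2 + 4 * q) * a ^ 2 = -4) :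
    ∃ r : ℤ, 2 ∣ r ∧ 4 ≤ |r| ∧ p = 2 * r ∧ q = -(r ^ 2 + 1) ∧
      ((a = 1 ∧ c = 0) ∨ (a = -1 ∧ c = 0)) ∧
      (!![(c - a * p) / 2, a; a * q, (c + a * p) / 2] = !![-r, 1; -(r ^ 2 + 1), r] ∨
       !![(c - a * p) / 2, a; a * q, (c + a * p) / 2] = -!![-r, 1; -(r ^ 2 + 1), r]) := by
  obtain ⟨r, rfl⟩ : (2 : ℤ) ∣ p :=
    Int.prime_two.dvd_of_dvd_pow (n := 2) ⟨-2 - 2 * q, by linarith⟩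
  obtain rfl : q = -(r ^ 2 + 1) := by linarith
  have hr : (2 : ℤ) ∣ r := by
    by_contra hodd
    have hq : (2 : ℤ) ∣ -(r ^ 2 + 1) := by
      obtain ⟨k, rfl⟩ : Odd r := by rwa [← Int.not_even_iff_odd, even_iff_two_dvd]
      exact ⟨-(2 * k ^ 2 + 2 * k + 1), by ring⟩
    have h := Int.dvd_coe_gcd (dvd_mul_right 2 r) hq
    rw [hgcd] at h
    norm_num at h
  have habs : 4 ≤ |r| := by
    rw [abs_neg, abs_of_pos (by positivity : 0 < r ^ 2 + 1), abs_mul, abs_two,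
      ← sq_abs r] at hpq
    have hlt : 2 < |r| := by nlinarith [abs_nonneg r]
    have heven : (2 : ℤ) ∣ |r| := (dvd_abs 2 r).mpr hr
    omega
  rw [hn] at hc
  have hsum : c ^ 2 + 4 * a ^ 2 = 4 := by
    rcases hc with h | h
    · linarith
    · nlinarith [sq_nonneg c, sq_nonneg a]
  have ha_sq : a ^ 2 = 1 :=
    le_antisymm (by nlinarith [sq_nonneg c]) (Int.add_one_le_of_lt (sq_pos_iff.mpr ha))
  obtain rfl : c = 0 := pow_eq_zero_iff two_ne_zero |>.mp (by linarith)
  refine ⟨r, hr, habs, rfl, rfl, ?_⟩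
  rcases (by simpa using ha_sq : a = 1 ∨ a = -1) with rfl | rfl
  · refine ⟨Or.inl ⟨rfl, rfl⟩, Or.inl ?_⟩
    rw [show (0 - 1 * (2 * r)) / 2 = -r by omega, show (0 + 1 * (2 * r)) / 2 = r by omega, one_mul]
  · refine ⟨Or.inr ⟨rfl, rfl⟩, Or.inr ?_⟩
    rw [show (0 - -1 * (2 * r)) / 2 = r by omega, show (0 + -1 * (2 * r)) / 2 = -r by omega]
    simp
end

section
/- Suppose p, q, a, c are integers with 1 + |p| < |q|, gcd(p, q) = 1, p² + 4q = −3, a ≠ 0, and c² − (p² + 4q)a² = 4 or −4. Then there is an integer r with (r ≤ −3 or r ≥ 2) and (r ≡ 0 (mod 3) or r ≡ 2 (mod 3)) such that p = 2r + 1 and q = −(r² + r + 1), and (a, c) ∈ {(1, 1), (1, −1), (−1, 1), (−1, −1)}; consequently the matrix [[(c − ap)/2, a], [aq, (c + ap)/2]] equals ±[[−r, 1], [−(r² + r + 1), r + 1]] or ±[[−(r + 1), 1], [−(r² + r + 1), r]]. -/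
/-- The case `n = p² + 4q = −3` of the classification: the solutions with `1 + |p| < |q|`,
`gcd(p, q) = 1`, `a ≠ 0` and `c² − (p² + 4q)a² = ±4` have `p = 2r + 1`,
`q = −(r² + r + 1)` for an integer `r` with `r ≤ −3` or `r ≥ 2` and `r ≡ 0` or `2 (mod 3)`,
with `(a, c) = (±1, ±1)`, and the corresponding matrix is
`±[[−r, 1], [−(r² + r + 1), r + 1]]` or `±[[−(r + 1), 1], [−(r² + r + 1), r]]`. -/
theorem classification_n_neg_three (p q a c : ℤ) (hpq : 1 + |p| < |q|)
    (hgcd : Int.gcd p q = 1) (hn : p ^ 2 + 4 * q = -3) (ha : a ≠ 0)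
    (hc : c ^ 2 - (p ^ 2 + 4 * q) * a ^ 2 = 4 ∨ c ^ 2 - (p ^ 2 + 4 * q) * a ^ 2 = -4) :
    ∃ r : ℤ, (r ≤ -3 ∨ 2 ≤ r) ∧ (r % 3 = 0 ∨ r % 3 = 2) ∧
      p = 2 * r + 1 ∧ q = -(r ^ 2 + r + 1) ∧
      ((a = 1 ∧ c = 1) ∨ (a = 1 ∧ c = -1) ∨ (a = -1 ∧ c = 1) ∨ (a = -1 ∧ c = -1)) ∧
      (!![(c - a * p) / 2, a; a * q, (c + a * p) / 2] =
          !![-r, 1; -(r ^ 2 + r + 1), r + 1] ∨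
       !![(c - a * p) / 2, a; a * q, (c + a * p) / 2] =
          -!![-r, 1; -(r ^ 2 + r + 1), r + 1] ∨
       !![(c - a * p) / 2, a; a * q, (c + a * p) / 2] =
          !![-(r + 1), 1; -(r ^ 2 + r + 1), r] ∨
       !![(c - a * p) / 2, a; a * q, (c + a * p) / 2] =
          -!![-(r + 1), 1; -(r ^ 2 + r + 1), r]) := by
  have hc4 : c ^ 2 + 3 * a ^ 2 = 4 := by
    rw [hn] at hc
    rcases hc with h | h
    · linarith
    · nlinarith [sq_nonneg a, sq_nonneg c]
  obtain ⟨r, hp⟩ : ∃ r : ℤ, p = 2 * r + 1 := by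
    have hodd : Odd (p ^ 2) := ⟨-2 * q - 2, by linarith⟩
    exact Int.Odd.of_mul_left (pow_two p ▸ hodd)
  have hq : q = -(r ^ 2 + r + 1) := by
    subst hp
    linarith
  have hac : (a = 1 ∨ a = -1) ∧ (c = 1 ∨ c = -1) := by
    have ha0 : 0 < a ^ 2 := by positivity
    have ha2 : a ^ 2 = 1 := by nlinarith [sq_nonneg c]
    exact ⟨mul_self_eq_one_iff.mp (by linarith), mul_self_eq_one_iff.mp (by linarith)⟩
  subst hp hq
  refine ⟨r, ?_, ?_, rfl, rfl, by tauto, ?_⟩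
  · have hpos : 0 < r ^ 2 + r + 1 := by nlinarith [sq_nonneg (2 * r + 1)]
    rw [abs_neg, abs_of_pos hpos] at hpq
    by_contra! hr
    obtain ⟨hr₁, hr₂⟩ := hr
    interval_cases r <;> norm_num at hpq
  · by_contra! hr
    obtain ⟨k, rfl⟩ : ∃ k, r = 3 * k + 1 := ⟨r / 3, by omega⟩
    have h3 : (3 : ℤ) ∣ Int.gcd (2 * (3 * k + 1) + 1) (-((3 * k + 1) ^ 2 + (3 * k + 1) + 1)) :=
      Int.dvd_coe_gcd ⟨2 * k + 1, by ring⟩ ⟨-(3 * k ^ 2 + 3 * k + 1), by ring⟩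
    rw [hgcd] at h3
    norm_num at h3
  · obtain ⟨rfl | rfl, rfl | rfl⟩ := hac
    · left
      ext i j
      fin_cases i <;> fin_cases j <;> simp <;> omega
    · right; right; left
      ext i j
      fin_cases i <;> fin_cases j <;> simp <;> omega
    · right; right; right
      ext i j
      fin_cases i <;> fin_cases j <;> simp <;> omega
    · right; left
      ext i j
      fin_cases i <;> fin_cases j <;> simp <;> omega
end
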